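/- arXiv:1006.1022 — 3 statements merged into one kernel-verified Lean document; each statement's English description precedes it below -/
import Mathlib

section
/- Let X be a real inner product space and x, y ∈ X such that ‖x+y‖ ≤ ‖γx + γ⁻¹y‖ for every nonzero real γ. Then ‖x‖ = ‖y‖. -/
/-- Squaring the norm inequality cancels the inner product term. -/
theorem sq_sub_one_mul_nonneg_of_norm_add_le {X : Type*} [NormedAddCommGroup X]
    [InnerProductSpace ℝ X] {x y : X} {γ : ℝ} (hγ : γ ≠ 0)
    (h : ‖x + y‖ ≤ ‖γ • x + γ⁻¹ • y‖) :
    0 ≤ (γ ^ 2 - 1) * ((γ * ‖x‖) ^ 2 - ‖y‖ ^ 2) := by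
  have hsq := pow_le_pow_left₀ (norm_nonneg _) h 2
  rw [norm_add_sq_real, norm_add_sq_real, real_inner_smul_left, real_inner_smul_right,
    mul_inv_cancel_left₀ hγ, norm_smul, norm_smul, mul_pow, mul_pow, Real.norm_eq_abs,
    Real.norm_eq_abs, sq_abs, sq_abs] at hsq
  have hdiff : 0 ≤ γ ^ 2 * ‖x‖ ^ 2 + γ⁻¹ ^ 2 * ‖y‖ ^ 2 - ‖x‖ ^ 2 - ‖y‖ ^ 2 := by linarith
  calc 0 ≤ γ ^ 2 * (γ ^ 2 * ‖x‖ ^ 2 + γ⁻¹ ^ 2 * ‖y‖ ^ 2 - ‖x‖ ^ 2 - ‖y‖ ^ 2) :=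
        mul_nonneg (sq_nonneg γ) hdiff
    _ = (γ ^ 2 - 1) * ((γ * ‖x‖) ^ 2 - ‖y‖ ^ 2) := by
        field_simp
        ring

theorem lorch_converse_inner {X : Type*} [NormedAddCommGroup X] [InnerProductSpace ℝ X]
    (x y : X) (h : ∀ γ : ℝ, γ ≠ 0 → ‖x + y‖ ≤ ‖γ • x + γ⁻¹ • y‖) :
    ‖x‖ = ‖y‖ := by
  have hx := norm_nonneg x
  have hy := norm_nonneg y
  rcases lt_trichotomy ‖x‖ ‖y‖ with hlt | heq | hgt
  · have hsum : 0 < ‖x‖ + ‖y‖ := by linarith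
    have hγ : 1 < 2 * ‖y‖ / (‖x‖ + ‖y‖) := by
      rw [lt_div_iff₀ hsum]
      linarith
    have hγx : 2 * ‖y‖ / (‖x‖ + ‖y‖) * ‖x‖ < ‖y‖ := by
      rw [div_mul_eq_mul_div, div_lt_iff₀ hsum]
      nlinarith
    have hne := (zero_lt_one.trans hγ).ne'
    have hnonneg := sq_sub_one_mul_nonneg_of_norm_add_le hne (h _ hne)
    have hneg := mul_neg_of_pos_of_neg (sub_pos.2 (one_lt_pow₀ hγ two_ne_zero))
      (sub_neg.2 (pow_lt_pow_left₀ hγx (by positivity) two_ne_zero))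
    exact absurd hneg hnonneg.not_gt
  · exact heq
  · have hpos : 0 < ‖x‖ := by linarith
    have hγ : (‖x‖ + ‖y‖) / (2 * ‖x‖) < 1 := by
      rw [div_lt_one (by positivity)]
      linarith
    have hγx : ‖y‖ < (‖x‖ + ‖y‖) / (2 * ‖x‖) * ‖x‖ := by
      rw [div_mul_eq_mul_div, lt_div_iff₀ (by positivity)]
      nlinarith
    have hne : (‖x‖ + ‖y‖) / (2 * ‖x‖) ≠ 0 := by positivity
    have hnonneg := sq_sub_one_mul_nonneg_of_norm_add_le hne (h _ hne)
    have hneg := mul_neg_of_neg_of_pos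
      (sub_neg.2 (pow_lt_one₀ (by positivity) hγ two_ne_zero))
      (sub_pos.2 (pow_lt_pow_left₀ hγx hy two_ne_zero))
    exact absurd hneg hnonneg.not_gt
end

section
/- Let X be a real normed space such that ‖x/‖x‖ − y/‖y‖‖ ≤ 2‖x−y‖/(‖x‖+‖y‖) for all nonzero x, y ∈ X. Then X is an inner product space (the norm satisfies the parallelogram law). -/
/-- The Dunkl–Williams inequality with constant `2`. -/
def KirkSmileyIneq (X : Type*) [NormedAddCommGroup X] [NormedSpace ℝ X] : Prop :=
  ∀ x y : X, x ≠ 0 → y ≠ 0 → ‖‖x‖⁻¹ • x - ‖y‖⁻¹ • y‖ ≤ 2 * ‖x - y‖ / (‖x‖ + ‖y‖)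

/-- Birkhoff–James orthogonality. -/
def BirkhoffOrtho {X : Type*} [NormedAddCommGroup X] [NormedSpace ℝ X] (p q : X) : Prop :=
  ∀ t : ℝ, ‖p‖ ≤ ‖p + t • q‖

section

variable {X : Type*} [NormedAddCommGroup X] [NormedSpace ℝ X]

theorem BirkhoffOrtho.smul {p q : X} (hpq : BirkhoffOrtho p q) (a b : ℝ) :
    BirkhoffOrtho (a • p) (b • q) := by
  intro t
  by_cases ha : a = 0
  · simp [ha]
  have e : a • p + t • b • q = a • (p + (t * b / a) • q) := by
    match_scalars <;> field_simp
  rw [e, norm_smul, norm_smul]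
  exact mul_le_mul_of_nonneg_left (hpq _) (norm_nonneg a)

/-- It suffices to test Birkhoff orthogonality on small perturbations. -/
theorem BirkhoffOrtho.of_small {p q : X}
    (hpq : ∀ t : ℝ, |t| < 1 → ‖p‖ ≤ ‖p + t • q‖) : BirkhoffOrtho p q := by
  intro t
  have ht : (0 : ℝ) < 1 + |t| := by positivity
  set r : ℝ := (1 + |t|)⁻¹ with hr
  have hr0 : 0 < r := by positivity
  have hr1 : r ≤ 1 := inv_le_one_of_one_le₀ (by linarith [abs_nonneg t])
  have h1 : |r * t| < 1 := by
    rw [abs_mul, abs_of_pos hr0, hr, inv_mul_lt_iff₀ ht]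
    linarith
  have h2 := hpq _ h1
  have e : p + (r * t) • q = (1 - r) • p + r • (p + t • q) := by module
  have h3 := norm_add_le ((1 - r) • p) (r • (p + t • q))
  rw [← e, norm_smul, norm_smul, Real.norm_of_nonneg hr0.le,
    Real.norm_of_nonneg (sub_nonneg.2 hr1)] at h3
  have h4 : r * ‖p‖ ≤ r * ‖p + t • q‖ := by linarith
  exact le_of_mul_le_mul_left h4 hr0

/-- Isosceles orthogonality implies Birkhoff orthogonality. -/
theorem KirkSmileyIneq.birkhoffOrtho (h : KirkSmileyIneq X) {p q : X}
    (hpq : ‖p + q‖ = ‖p - q‖) : BirkhoffOrtho p q := by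
  refine BirkhoffOrtho.of_small fun t ht => ?_
  obtain ⟨ht1, ht2⟩ := abs_lt.1 ht
  by_cases h0 : p + q = 0
  · have h1 : p - q = 0 := by rw [← norm_eq_zero, ← hpq, h0, norm_zero]
    have : p = 0 := by
      have e : p = (1 / 2 : ℝ) • ((p + q) + (p - q)) := by module
      rw [e, h0, h1]; simp
    simp [this]
  have hρ : 0 < ‖p + q‖ := norm_pos_iff.2 h0
  have h1 : p - q ≠ 0 := norm_pos_iff.1 (hpq ▸ hρ)
  have ha : 0 < (1 + t) / 2 := by linarith
  have hb : 0 < (1 - t) / 2 := by linarith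
  have key := h (((1 + t) / 2) • (p + q)) (-(((1 - t) / 2) • (p - q)))
    (smul_ne_zero ha.ne' h0) (neg_ne_zero.2 (smul_ne_zero hb.ne' h1))
  rw [norm_neg, norm_smul, norm_smul, Real.norm_of_nonneg ha.le, Real.norm_of_nonneg hb.le,
    ← hpq] at key
  set ρ := ‖p + q‖
  have e1 : ((1 + t) / 2) • (p + q) - -(((1 - t) / 2) • (p - q)) = p + t • q := by module
  have e2 : ((1 + t) / 2 * ρ)⁻¹ • ((1 + t) / 2) • (p + q)
      - ((1 - t) / 2 * ρ)⁻¹ • -(((1 - t) / 2) • (p - q)) = (2 / ρ) • p := by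
    have i1 : ((1 + t) / 2 * ρ)⁻¹ * ((1 + t) / 2) = ρ⁻¹ := by
      rw [mul_inv, mul_right_comm, inv_mul_cancel₀ ha.ne', one_mul]
    have i2 : ((1 - t) / 2 * ρ)⁻¹ * ((1 - t) / 2) = ρ⁻¹ := by
      rw [mul_inv, mul_right_comm, inv_mul_cancel₀ hb.ne', one_mul]
    rw [smul_neg, smul_smul, smul_smul, i1, i2]
    module
  have e3 : (1 + t) / 2 * ρ + (1 - t) / 2 * ρ = ρ := by ring
  rw [e1, e2, e3, norm_smul, Real.norm_of_nonneg (by positivity), div_mul_eq_mul_div,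
    div_le_div_iff_of_pos_right hρ] at key
  linarith

/-- A flat segment of the sphere can be prolonged. -/
theorem KirkSmileyIneq.norm_add_two_smul (h : KirkSmileyIneq X) {p q : X}
    (h1 : ‖p + q‖ = ‖p‖) (h2 : ‖p - q‖ = ‖p‖) : ‖p + (2 : ℝ) • q‖ = ‖p‖ := by
  by_cases hp : p = 0
  · have : q = 0 := by simpa [hp] using h1
    simp [hp, this]
  have hρ : 0 < ‖p‖ := norm_pos_iff.2 hp
  have hN : ‖p‖ ≤ ‖p + (2 : ℝ) • q‖ := by
    have := norm_add_le p (p + (2 : ℝ) • q)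
    have e : p + (p + (2 : ℝ) • q) = (2 : ℝ) • (p + q) := by module
    rw [e, norm_smul, h1, Real.norm_of_nonneg zero_le_two] at this
    linarith
  have key := h (p - q) (-(p + (2 : ℝ) • q)) (norm_pos_iff.1 (h2 ▸ hρ))
    (neg_ne_zero.2 (norm_pos_iff.1 (hρ.trans_le hN)))
  rw [norm_neg, h2] at key
  set N := ‖p + (2 : ℝ) • q‖
  set ρ := ‖p‖
  have hN0 : 0 < N := hρ.trans_le hN
  have up1 : ‖p - q - -(p + (2 : ℝ) • q)‖ ≤ 2 * ρ := by
    have e : p - q - -(p + (2 : ℝ) • q) = p + (p + q) := by module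
    rw [e]
    linarith [norm_add_le p (p + q)]
  have low : 1 + ρ / N ≤ ‖ρ⁻¹ • (p - q) - N⁻¹ • -(p + (2 : ℝ) • q)‖ := by
    set w := ρ⁻¹ • (p - q) - N⁻¹ • -(p + (2 : ℝ) • q)
    have e1 : (2 * (ρ⁻¹ + N⁻¹)) • p
        = w + ((3 / 2 * N⁻¹) • (p - q) + (ρ⁻¹ - 1 / 2 * N⁻¹) • (p + q)) := by
      simp only [w]; module
    have hc : 0 ≤ ρ⁻¹ - 1 / 2 * N⁻¹ := by
      have : N⁻¹ ≤ ρ⁻¹ := inv_anti₀ hρ hN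
      have : 0 < N⁻¹ := by positivity
      linarith
    have t1 := norm_add_le w ((3 / 2 * N⁻¹) • (p - q) + (ρ⁻¹ - 1 / 2 * N⁻¹) • (p + q))
    have t2 := norm_add_le ((3 / 2 * N⁻¹) • (p - q)) ((ρ⁻¹ - 1 / 2 * N⁻¹) • (p + q))
    rw [← e1, norm_smul, Real.norm_of_nonneg (by positivity)] at t1
    rw [norm_smul, norm_smul, Real.norm_of_nonneg (by positivity), Real.norm_of_nonneg hc,
      h1, h2] at t2
    change _ * ρ ≤ _ at t1
    have e2 : ρ⁻¹ * ρ = 1 := inv_mul_cancel₀ hρ.ne'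
    rw [div_eq_inv_mul]
    nlinarith
  have fin : 1 + ρ / N ≤ 2 * (2 * ρ) / (ρ + N) :=
    low.trans (key.trans (by gcongr))
  have e : 1 + ρ / N = (N + ρ) / N := by field_simp
  rw [e, div_le_div_iff₀ hN0 (by positivity)] at fin
  have : (N - ρ) ^ 2 ≤ 0 := by nlinarith
  have := pow_eq_zero_iff (two_ne_zero) |>.1 (le_antisymm this (sq_nonneg _))
  linarith

/-- The unit sphere contains no segment. -/
theorem KirkSmileyIneq.eq_zero_of_norm_add_of_norm_sub (h : KirkSmileyIneq X) {p q : X}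
    (h1 : ‖p + q‖ = ‖p‖) (h2 : ‖p - q‖ = ‖p‖) : q = 0 := by
  have H : ∀ n : ℕ, ‖p + (2 ^ n : ℝ) • q‖ = ‖p‖ ∧ ‖p - (2 ^ n : ℝ) • q‖ = ‖p‖ := by
    intro n
    induction n with
    | zero => simpa using ⟨h1, h2⟩
    | succ n ih =>
      obtain ⟨i1, i2⟩ := ih
      have j1 := h.norm_add_two_smul i1 i2
      have j2 := h.norm_add_two_smul (p := p) (q := -((2 ^ n : ℝ) • q))
        (by rwa [← sub_eq_add_neg]) (by rwa [sub_neg_eq_add])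
      rw [smul_smul, ← pow_succ'] at j1
      rw [smul_neg, smul_smul, ← pow_succ', ← sub_eq_add_neg] at j2
      exact ⟨j1, j2⟩
  by_contra hq
  have hq0 : 0 < ‖q‖ := norm_pos_iff.2 hq
  obtain ⟨n, hn⟩ := pow_unbounded_of_one_lt (2 * ‖p‖ / ‖q‖) (one_lt_two (α := ℝ))
  rw [div_lt_iff₀ hq0] at hn
  have := norm_sub_le (p + (2 ^ n : ℝ) • q) p
  rw [add_sub_cancel_left, norm_smul, (H n).1, Real.norm_of_nonneg (by positivity)] at this
  linarith

/-- The foot of the Birkhoff perpendicular to a line is unique. -/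
theorem KirkSmileyIneq.eq_zero_of_birkhoffOrtho (h : KirkSmileyIneq X) {p q : X} {c : ℝ}
    (hq : q ≠ 0) (h1 : BirkhoffOrtho p q) (h2 : BirkhoffOrtho (p + c • q) q) : c = 0 := by
  have e0 : ‖p + c • q‖ = ‖p‖ := by
    refine le_antisymm ?_ (h1 c)
    have := h2 (-c)
    rwa [neg_smul, add_neg_cancel_right] at this
  have em : ‖p + (c / 2) • q‖ = ‖p‖ := by
    refine le_antisymm ?_ (h1 _)
    have := norm_add_le p (p + c • q)
    have e : p + (p + c • q) = (2 : ℝ) • (p + (c / 2) • q) := by module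
    rw [e, e0, norm_smul, Real.norm_of_nonneg zero_le_two] at this
    linarith
  have := h.eq_zero_of_norm_add_of_norm_sub (p := p + (c / 2) • q) (q := (c / 2) • q)
    (by rw [em, ← e0]; congr 1; module) (by rw [em]; congr 1; module)
  rcases smul_eq_zero.1 this with h | h
  · linarith
  · exact absurd h hq

/-- Birkhoff orthogonality implies isosceles orthogonality. -/
theorem KirkSmileyIneq.norm_add_eq_norm_sub (h : KirkSmileyIneq X) {p q : X}
    (hpq : BirkhoffOrtho p q) : ‖p + q‖ = ‖p - q‖ := by
  by_cases hq : q = 0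
  · simp [hq]
  have hq0 : 0 < ‖q‖ := norm_pos_iff.2 hq
  set R : ℝ := (‖p + q‖ + ‖p‖) / ‖q‖
  have hR : 0 ≤ R := by positivity
  have hcont : ContinuousOn (fun t : ℝ => ‖p - t • q‖) (Set.Icc 0 R) := by fun_prop
  have hfar : ‖p + q‖ ≤ ‖p - R • q‖ := by
    have := norm_sub_norm_le (R • q) p
    rw [norm_smul, Real.norm_of_nonneg hR, div_mul_cancel₀ _ hq0.ne', norm_sub_rev] at this
    linarith
  have hnear : ‖p - (0 : ℝ) • q‖ ≤ ‖p + q‖ := by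
    have := hpq 1
    rw [one_smul] at this
    simpa using this
  obtain ⟨t, ⟨ht, -⟩, hteq⟩ := intermediate_value_Icc hR hcont ⟨hnear, hfar⟩
  simp only at hteq
  have hm : BirkhoffOrtho (p + ((1 - t) / 2) • q) (((1 + t) / 2) • q) := by
    refine h.birkhoffOrtho ?_
    have e1 : p + ((1 - t) / 2) • q + ((1 + t) / 2) • q = p + q := by module
    have e2 : p + ((1 - t) / 2) • q - ((1 + t) / 2) • q = p - t • q := by module
    rw [e1, e2, hteq]
  have hm' := hm.smul 1 ((1 + t) / 2)⁻¹
  rw [one_smul, smul_smul, inv_mul_cancel₀ (by positivity), one_smul] at hm'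
  have := h.eq_zero_of_birkhoffOrtho hq hpq hm'
  have ht1 : t = 1 := by linarith
  rw [← hteq, ht1, one_smul]

theorem KirkSmileyIneq.birkhoffOrtho_symm (h : KirkSmileyIneq X) {p q : X}
    (hpq : BirkhoffOrtho p q) : BirkhoffOrtho q p :=
  h.birkhoffOrtho (by rw [add_comm, h.norm_add_eq_norm_sub hpq, norm_sub_rev])

theorem KirkSmileyIneq.norm_smul_add_smul_eq_norm_sub (h : KirkSmileyIneq X) {p q : X}
    (hpq : BirkhoffOrtho p q) (a b : ℝ) : ‖a • p + b • q‖ = ‖a • p - b • q‖ :=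
  h.norm_add_eq_norm_sub (hpq.smul a b)

/-- Ficken's condition. -/
theorem KirkSmileyIneq.norm_smul_add_smul_comm (h : KirkSmileyIneq X) {u v : X}
    (huv : ‖u‖ = ‖v‖) (a b : ℝ) : ‖a • u + b • v‖ = ‖b • u + a • v‖ := by
  have hB : BirkhoffOrtho (u + v) (u - v) := by
    refine h.birkhoffOrtho ?_
    have e1 : u + v + (u - v) = (2 : ℝ) • u := by module
    have e2 : u + v - (u - v) = (2 : ℝ) • v := by module
    rw [e1, e2, norm_smul, norm_smul, huv]
  have := h.norm_smul_add_smul_eq_norm_sub hB ((a + b) / 2) ((a - b) / 2)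
  have e1 : ((a + b) / 2) • (u + v) + ((a - b) / 2) • (u - v) = a • u + b • v := by module
  have e2 : ((a + b) / 2) • (u + v) - ((a - b) / 2) • (u - v) = b • u + a • v := by module
  rwa [e1, e2] at this

theorem KirkSmileyIneq.sq_add_sq_eq_one (h : KirkSmileyIneq X) {p q : X}
    (hp : ‖p‖ = 1) (hq : ‖q‖ = 1) (hpq : BirkhoffOrtho p q) {a b : ℝ} (ha : a ≠ 0) (hb : b ≠ 0)
    (hu : ‖a • p + b • q‖ = 1) : a ^ 2 + b ^ 2 = 1 := by
  have hr : a ^ 2 + b ^ 2 ≠ 0 := by positivity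
  set u := a • p + b • q
  set v := (-b) • p + a • q
  have hu0 : u ≠ 0 := norm_pos_iff.1 (by rw [hu]; exact one_pos)
  have hvu : BirkhoffOrtho v u := by
    refine h.birkhoffOrtho ?_
    have e1 : v + u = (a - b) • p + (a + b) • q := by simp only [u, v]; module
    have e2 : v - u = -((a + b) • p - (a - b) • q) := by simp only [u, v]; module
    rw [e1, e2, norm_neg, ← h.norm_smul_add_smul_eq_norm_sub hpq,
      h.norm_smul_add_smul_comm (hp.trans hq.symm)]
  -- `w` is the image of `q` under the isometry exchanging `p` and `u`.
  set w := b⁻¹ • (p - a • u)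
  have hwu : BirkhoffOrtho w u := by
    refine h.birkhoffOrtho ?_
    have e1 : w + u = b⁻¹ • p + (1 - b⁻¹ * a) • u := by simp only [w]; module
    have e2 : w - u = b⁻¹ • p + (-1 - b⁻¹ * a) • u := by simp only [w]; module
    have e3 : (1 - b⁻¹ * a) • p + b⁻¹ • u = p + q := by
      simp only [u]; match_scalars <;> field_simp; ring
    have e4 : (-1 - b⁻¹ * a) • p + b⁻¹ • u = -(p - q) := by
      simp only [u]; match_scalars <;> field_simp; ring
    rw [e1, e2, h.norm_smul_add_smul_comm (hp.trans hu.symm) b⁻¹,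
      h.norm_smul_add_smul_comm (hp.trans hu.symm) b⁻¹, e3, e4, norm_neg,
      h.norm_add_eq_norm_sub hpq]
  have hvu' := hvu.smul (-(a ^ 2 + b ^ 2)⁻¹) 1
  rw [one_smul] at hvu'
  have e : w = (-(a ^ 2 + b ^ 2)⁻¹) • v
      + (a * (1 - (a ^ 2 + b ^ 2)) / (b * (a ^ 2 + b ^ 2))) • u := by
    simp only [w, v, u]; match_scalars <;> field_simp <;> ring
  rw [e] at hwu
  have h0 := h.eq_zero_of_birkhoffOrtho hu0 hvu' hwu
  rw [div_eq_zero_iff] at h0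
  rcases h0 with h0 | h0
  · rcases mul_eq_zero.1 h0 with h0 | h0
    · exact absurd h0 ha
    · linarith
  · exact absurd h0 (mul_ne_zero hb hr)

/-- Pythagoras' theorem for orthonormal pairs. -/
theorem KirkSmileyIneq.norm_smul_add_smul_sq (h : KirkSmileyIneq X) {p q : X}
    (hp : ‖p‖ = 1) (hq : ‖q‖ = 1) (hpq : BirkhoffOrtho p q) (a b : ℝ) :
    ‖a • p + b • q‖ ^ 2 = a ^ 2 + b ^ 2 := by
  by_cases ha : a = 0
  · simp [ha, norm_smul, hq]
  by_cases hb : b = 0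
  · simp [hb, norm_smul, hp]
  have hN : 0 < ‖a • p + b • q‖ := by
    have := hpq.smul a b 1
    rw [one_smul, norm_smul, hp, mul_one] at this
    exact (norm_pos_iff.2 ha).trans_le this
  set N := ‖a • p + b • q‖ with hNdef
  have h1 : ‖(a / N) • p + (b / N) • q‖ = 1 := by
    have e : (a / N) • p + (b / N) • q = N⁻¹ • (a • p + b • q) := by module
    rw [e, norm_smul, ← hNdef, Real.norm_of_nonneg (by positivity), inv_mul_cancel₀ hN.ne']
  have := h.sq_add_sq_eq_one hp hq hpq (div_ne_zero ha hN.ne') (div_ne_zero hb hN.ne') h1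
  field_simp at this
  linarith

/-- Pythagoras' theorem. -/
theorem KirkSmileyIneq.norm_smul_add_sq (h : KirkSmileyIneq X) {x z : X}
    (hzx : BirkhoffOrtho z x) (a b : ℝ) :
    ‖a • x + b • z‖ ^ 2 = a ^ 2 * ‖x‖ ^ 2 + b ^ 2 * ‖z‖ ^ 2 := by
  by_cases hx : x = 0
  · simp [hx, norm_smul, mul_pow]
  by_cases hz : z = 0
  · simp [hz, norm_smul, mul_pow]
  have hx0 : ‖x‖ ≠ 0 := norm_ne_zero_iff.2 hx
  have hz0 : ‖z‖ ≠ 0 := norm_ne_zero_iff.2 hz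
  have := h.norm_smul_add_smul_sq (p := ‖x‖⁻¹ • x) (q := ‖z‖⁻¹ • z)
    (by simp [norm_smul, hx0]) (by simp [norm_smul, hz0])
    ((h.birkhoffOrtho_symm hzx).smul _ _) (a * ‖x‖) (b * ‖z‖)
  rw [smul_smul, smul_smul, mul_assoc, mul_assoc, mul_inv_cancel₀ hx0, mul_inv_cancel₀ hz0,
    mul_one, mul_one] at this
  rw [this]; ring

theorem exists_birkhoffOrtho_add_smul (x y : X) : ∃ t : ℝ, BirkhoffOrtho (y + t • x) x := by
  by_cases hx : x = 0
  · exact ⟨0, fun s => by simp [hx]⟩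
  have hx0 : 0 < ‖x‖ := norm_pos_iff.2 hx
  set R : ℝ := 2 * ‖y‖ / ‖x‖ with hRdef
  have hR : 0 ≤ R := by positivity
  have hcont : ContinuousOn (fun t : ℝ => ‖y + t • x‖) (Set.Icc (-R) R) := by fun_prop
  obtain ⟨t, -, ht⟩ := isCompact_Icc.exists_isMinOn ⟨0, by simpa using hR⟩ hcont
  rw [isMinOn_iff] at ht
  have ht0 : ‖y + t • x‖ ≤ ‖y‖ := by simpa using ht 0 ⟨by linarith, hR⟩
  refine ⟨t, fun s => ?_⟩
  have e : y + t • x + s • x = y + (t + s) • x := by module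
  rw [e]
  by_cases hs : |t + s| ≤ R
  · exact ht _ (abs_le.1 hs)
  · push Not at hs
    rw [hRdef, div_lt_iff₀ hx0] at hs
    have := norm_sub_le (y + (t + s) • x) y
    rw [add_sub_cancel_left, norm_smul, Real.norm_eq_abs] at this
    linarith

end

theorem kirk_smiley {X : Type*} [NormedAddCommGroup X] [NormedSpace ℝ X]
    (h : ∀ x y : X, x ≠ 0 → y ≠ 0 →
      ‖‖x‖⁻¹ • x - ‖y‖⁻¹ • y‖ ≤ 2 * ‖x - y‖ / (‖x‖ + ‖y‖)) :
    ∀ x y : X, ‖x + y‖ ^ 2 + ‖x - y‖ ^ 2 = 2 * ‖x‖ ^ 2 + 2 * ‖y‖ ^ 2 := by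
  intro x y
  replace h : KirkSmileyIneq X := h
  obtain ⟨t, ht⟩ := exists_birkhoffOrtho_add_smul x y
  set z := y + t • x with hz
  have hy : y = (-t) • x + (1 : ℝ) • z := by rw [hz]; module
  have e1 : x + y = (1 - t) • x + (1 : ℝ) • z := by rw [hz]; module
  have e2 : x - y = (1 + t) • x + (-1 : ℝ) • z := by rw [hz]; module
  have f := congrArg (fun v => ‖v‖ ^ 2) hy
  rw [h.norm_smul_add_sq ht] at f
  rw [f, e1, e2, h.norm_smul_add_sq ht, h.norm_smul_add_sq ht]
  ring
end

section
/- Let X be a real normed space and p ∈ [0,1). The following are equivalent: (i) for all q ∈ (0,1] and all nonzero x, y ∈ X, α_p[x,y] ≤ 2^{1/q}·‖x−y‖/(‖x‖^{(1−p)q} + ‖y‖^{(1−p)q})^{1/q}; (ii) there exists q > 0 such that this inequality holds for all nonzero x, y; (iii) X is an inner product space. -/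
/-- Lorch's condition on a real normed space: the norm of a combination of two vectors of equal
norm is bounded below by the geometric mean of the coefficients times the norm of their sum. -/
def LorchCondition (X : Type*) [NormedAddCommGroup X] [NormedSpace ℝ X] : Prop :=
  ∀ u v : X, ‖u‖ = ‖v‖ → ∀ α β : ℝ, 0 < α → 0 < β →
    α * β * ‖u + v‖ ^ 2 ≤ ‖α • u + β • v‖ ^ 2

section NormedSpace

variable {X : Type*} [NormedAddCommGroup X] [NormedSpace ℝ X]

theorem add_le_norm_smul_add_smul {u w : X} (hu : ‖u‖ = 1) (hw : ‖w‖ = 1) (huw : ‖u + w‖ = 2)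
    {α β : ℝ} (hα : 0 ≤ α) (hβ : 0 ≤ β) : α + β ≤ ‖α • u + β • w‖ := by
  have key : ∀ {u w : X}, ‖w‖ = 1 → ‖u + w‖ = 2 → ∀ {α β : ℝ}, 0 ≤ α → β ≤ α →
      α + β ≤ ‖α • u + β • w‖ := by
    intro u w hw huw α β hα h
    have h1 := norm_sub_norm_le (α • (u + w)) ((α - β) • w)
    rw [norm_smul, norm_smul, huw, hw, Real.norm_of_nonneg hα,
      Real.norm_of_nonneg (sub_nonneg.2 h)] at h1
    have h2 : α • (u + w) - (α - β) • w = α • u + β • w := by module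
    rw [h2] at h1
    linarith
  rcases le_total β α with h | h
  · exact key hw huw hα h
  · rw [add_comm α, add_comm (α • u)]
    exact key hu (by rwa [add_comm]) hβ h

theorem exists_forall_norm_le_norm_add_smul {e : X} (he : ‖e‖ = 1) (y : X) :
    ∃ r : ℝ, ∀ t : ℝ, ‖y + r • e‖ ≤ ‖(y + r • e) + t • e‖ := by
  have hc : Continuous fun t : ℝ => ‖y + t • e‖ := by fun_prop
  have hlim : Filter.Tendsto (fun t : ℝ => ‖y + t • e‖) (Filter.cocompact ℝ) Filter.atTop := by
    refine Filter.tendsto_atTop_mono (f := fun t : ℝ => ‖t‖ - ‖y‖) (fun t => ?_)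
      (Filter.tendsto_atTop_add_const_right _ _ (tendsto_norm_cocompact_atTop (E := ℝ)))
    have h := norm_sub_norm_le (t • e) (-y)
    rw [norm_smul, he, mul_one, norm_neg, sub_neg_eq_add, add_comm (t • e)] at h
    exact h
  obtain ⟨r, hr⟩ := hc.exists_forall_le hlim
  refine ⟨r, fun t => ?_⟩
  rw [add_assoc, ← add_smul]
  exact hr _

namespace LorchCondition

theorem norm_add_two_smul_eq_one (hL : LorchCondition X) {u z : X} (hu : ‖u‖ = 1)
    (hz : ‖u + z‖ = 1) (huz : ‖u + (u + z)‖ = 2) : ‖u + (2 : ℝ) • z‖ = 1 := by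
  set ρ := ‖u + (2 : ℝ) • z‖ with hρ
  have hρ1 : 1 ≤ ρ := by
    have h := norm_sub_norm_le ((2 : ℝ) • (u + z)) u
    rw [norm_smul, hz, hu, show (2 : ℝ) • (u + z) - u = u + (2 : ℝ) • z by module] at h
    norm_num at h
    linarith
  have hρ0 : 0 < ρ := by linarith
  have hv : ‖ρ⁻¹ • (u + (2 : ℝ) • z)‖ = 1 := by
    rw [norm_smul, ← hρ, norm_inv, Real.norm_of_nonneg hρ0.le, inv_mul_cancel₀ hρ0.ne']
  have h1 := hL u (ρ⁻¹ • (u + (2 : ℝ) • z)) (by rw [hu, hv]) 1 ρ one_pos hρ0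
  rw [smul_smul, mul_inv_cancel₀ hρ0.ne',
    show (1 : ℝ) • u + (1 : ℝ) • (u + (2 : ℝ) • z) = (2 : ℝ) • (u + z) by module,
    norm_smul, hz] at h1
  have h2 := add_le_norm_smul_add_smul hu hz huz (α := 1 - ρ⁻¹) (β := 2 * ρ⁻¹)
    (sub_nonneg.2 (inv_le_one_of_one_le₀ hρ1)) (by positivity)
  rw [show (1 - ρ⁻¹) • u + (2 * ρ⁻¹) • (u + z) = u + ρ⁻¹ • (u + (2 : ℝ) • z) by module] at h2
  have h3 : (1 + ρ⁻¹) ^ 2 ≤ ‖u + ρ⁻¹ • (u + (2 : ℝ) • z)‖ ^ 2 := by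
    have : 0 < ρ⁻¹ := by positivity
    exact pow_le_pow_left₀ (by positivity) (by linarith) 2
  have h4 : ρ * (1 + ρ⁻¹) ^ 2 ≤ 4 := by
    have := mul_le_mul_of_nonneg_left h3 hρ0.le
    rw [Real.norm_two, one_mul] at h1
    linarith
  have h5 : ρ * (1 + ρ⁻¹) ^ 2 = ρ + 2 + ρ⁻¹ := by field_simp; ring
  have h6 : ρ * ρ⁻¹ = 1 := mul_inv_cancel₀ hρ0.ne'
  nlinarith [sq_nonneg (ρ - 1)]

theorem strictConvexSpace (hL : LorchCondition X) : StrictConvexSpace ℝ X := by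
  refine StrictConvexSpace.of_norm_add fun u w hu hw huw => ?_
  have key : ∀ n : ℕ, ‖u + (2 : ℝ) ^ n • (w - u)‖ = 1 ∧
      ‖u + (u + (2 : ℝ) ^ n • (w - u))‖ = 2 := by
    intro n
    induction n with
    | zero => simp [hw, huw]
    | succ n ih =>
      have h := hL.norm_add_two_smul_eq_one hu ih.1 ih.2
      rw [smul_smul, ← pow_succ'] at h
      refine ⟨h, ?_⟩
      rw [show u + (u + (2 : ℝ) ^ (n + 1) • (w - u)) =
        (2 : ℝ) • (u + (2 : ℝ) ^ n • (w - u)) by rw [pow_succ]; module, norm_smul, ih.1]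
      norm_num
  have hwu : w = u := by
    by_contra hne
    have hpos : 0 < ‖w - u‖ := norm_pos_iff.2 (sub_ne_zero.2 hne)
    obtain ⟨n, hn⟩ := pow_unbounded_of_one_lt (2 / ‖w - u‖) (one_lt_two (α := ℝ))
    rw [div_lt_iff₀ hpos] at hn
    have h := norm_sub_le (u + (2 : ℝ) ^ n • (w - u)) u
    rw [add_sub_cancel_left, (key n).1, hu, norm_smul, norm_pow, Real.norm_two] at h
    linarith
  rw [hwu]

/-- The sum of two vectors of equal norm is Birkhoff orthogonal to their difference. -/
theorem norm_add_le_norm_add_smul_sub (hL : LorchCondition X) {u v : X} (huv : ‖u‖ = ‖v‖)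
    (t : ℝ) : ‖u + v‖ ≤ ‖(u + v) + t • (u - v)‖ := by
  by_contra! hlt
  set F := ‖u + v‖ with hF
  set δ := F - ‖(u + v) + t • (u - v)‖ with hδ
  have hδ0 : 0 < δ := sub_pos.2 hlt
  have hFδ : δ ≤ F := sub_le_self _ (norm_nonneg _)
  have hF0 : 0 < F := hδ0.trans_le hFδ
  set D := δ ^ 2 + t ^ 2 * F ^ 2 + δ * F with hD
  have hD0 : 0 < D := by positivity
  set l := δ * F / D with hl
  have hl0 : 0 < l := by positivity
  have hlD : l * D = δ * F := div_mul_cancel₀ _ hD0.ne'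
  have hl1 : l ≤ 1 := by
    rw [hl, div_le_one hD0, hD]
    nlinarith [sq_nonneg δ, sq_nonneg (t * F)]
  have hlt1 : |l * t| < 1 := by
    rw [abs_mul, abs_of_pos hl0, hl, div_mul_eq_mul_div, div_lt_one hD0, hD]
    nlinarith [sq_nonneg (δ - |t| * F), sq_abs t, mul_pos hδ0 hF0, sq_nonneg (t * F)]
  obtain ⟨h1, h2⟩ := abs_lt.1 hlt1
  have hlow := hL u v huv (1 + l * t) (1 - l * t) (by linarith) (by linarith)
  have hup : ‖(1 + l * t) • u + (1 - l * t) • v‖ ≤ F - l * δ := by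
    rw [show (1 + l * t) • u + (1 - l * t) • v =
      (1 - l) • (u + v) + l • ((u + v) + t • (u - v)) by module]
    refine (norm_add_le _ _).trans ?_
    rw [norm_smul, norm_smul, Real.norm_of_nonneg hl0.le,
      Real.norm_of_nonneg (sub_nonneg.2 hl1), ← hF]
    have : ‖(u + v) + t • (u - v)‖ = F - δ := by rw [hδ]; ring
    rw [this]
    linarith
  have hup2 := pow_le_pow_left₀ (norm_nonneg _) hup 2
  have h3 : l * (2 * δ * F) ≤ l * (l * (δ ^ 2 + t ^ 2 * F ^ 2)) := by
    rw [← hF] at hlow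
    linarith
  have h4 := le_of_mul_le_mul_left h3 hl0
  have h5 : 0 < l * (δ * F) := by positivity
  have h6 : 0 < δ * F := by positivity
  rw [hD] at hlD
  linarith

theorem eq_or_add_eq_zero_of_norm_eq (hL : LorchCondition X) {a b : X} (ha : a ≠ 0)
    (hb : ∀ t : ℝ, ‖b‖ ≤ ‖b + t • a‖) {s r : ℝ} (h : ‖b + s • a‖ = ‖b + r • a‖) :
    s = r ∨ s + r = 0 := by
  have := hL.strictConvexSpace
  refine or_iff_not_imp_left.2 fun hsr => ?_
  have hsr' : s - r ≠ 0 := sub_ne_zero.2 hsr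
  have h1 := hL.norm_add_le_norm_add_smul_sub h (-(s + r) / (s - r))
  rw [show b + s • a - (b + r • a) = (s - r) • a by module, smul_smul,
    div_mul_cancel₀ _ hsr',
    show b + s • a + (b + r • a) + (-(s + r)) • a = (2 : ℝ) • b by module,
    show b + s • a + (b + r • a) = (2 : ℝ) • (b + ((s + r) / 2) • a) by module,
    norm_smul, norm_smul] at h1
  have h2 : ‖b‖ = ‖b + ((s + r) / 2) • a‖ :=
    le_antisymm (hb _) (le_of_mul_le_mul_left h1 (by norm_num))
  by_contra hne
  have h3 : b ≠ b + ((s + r) / 2) • a := by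
    rw [Ne, left_eq_add, smul_eq_zero, not_or]
    exact ⟨div_ne_zero hne two_ne_zero, ha⟩
  have h4 := (norm_midpoint_lt_iff h2).2 h3
  rw [show (1 / 2 : ℝ) • (b + (b + ((s + r) / 2) • a)) = b + ((s + r) / 4) • a by module] at h4
  exact h4.not_ge (hb _)

theorem norm_add_smul_le_norm_sub_smul (hL : LorchCondition X) {a b : X} (ha : a ≠ 0)
    (hb : ∀ t : ℝ, ‖b‖ ≤ ‖b + t • a‖) {s : ℝ} (hs : 0 < s) :
    ‖b + s • a‖ ≤ ‖b - s • a‖ := by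
  by_contra! hlt
  have ha' : 0 < ‖a‖ := norm_pos_iff.2 ha
  set R := ‖b + s • a‖ with hR
  set M := s + (R + ‖b‖) / ‖a‖ with hM
  have hsM : s ≤ M := le_add_of_nonneg_right (by positivity)
  have hMR : R ≤ ‖b - M • a‖ := by
    have h := norm_sub_norm_le (M • a) b
    rw [norm_smul, Real.norm_of_nonneg (hs.le.trans hsM), norm_sub_rev, hM, add_mul,
      div_mul_cancel₀ _ ha'.ne'] at h
    have := mul_pos hs ha'
    rw [hM]
    linarith
  have hc : ContinuousOn (fun r : ℝ => ‖b - r • a‖) (Set.Icc s M) := by fun_prop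
  obtain ⟨r, hr, hrR⟩ := intermediate_value_Icc hsM hc ⟨hlt.le, hMR⟩
  have hrR' : ‖b + s • a‖ = ‖b + (-r) • a‖ := by
    rw [neg_smul, ← sub_eq_add_neg]
    exact hrR.symm
  rcases hL.eq_or_add_eq_zero_of_norm_eq ha hb hrR' with h | h
  · linarith [hr.1]
  · have : r = s := by linarith
    subst this
    exact hlt.ne hrR

theorem norm_add_smul_eq_norm_sub_smul (hL : LorchCondition X) {a b : X} (ha : a ≠ 0)
    (hb : ∀ t : ℝ, ‖b‖ ≤ ‖b + t • a‖) (s : ℝ) : ‖b + s • a‖ = ‖b - s • a‖ := by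
  have key : ∀ s : ℝ, 0 < s → ‖b + s • a‖ = ‖b - s • a‖ := fun s hs => by
    refine le_antisymm (hL.norm_add_smul_le_norm_sub_smul ha hb hs) ?_
    have h := hL.norm_add_smul_le_norm_sub_smul (neg_ne_zero.2 ha)
      (fun t => by simpa using hb (-t)) hs
    simpa [← sub_eq_add_neg] using h
  rcases lt_trichotomy s 0 with hs | rfl | hs
  · have h := key (-s) (neg_pos.2 hs)
    rw [neg_smul, sub_neg_eq_add, ← sub_eq_add_neg] at h
    exact h.symm
  · simp
  · exact key s hs

/-- Ficken-type symmetry: two vectors of equal norm may be swapped in a linear combination. -/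
theorem norm_smul_add_smul_swap (hL : LorchCondition X) {u v : X} (huv : ‖u‖ = ‖v‖) (α β : ℝ) :
    ‖α • u + β • v‖ = ‖β • u + α • v‖ := by
  rcases eq_or_ne u v with rfl | hne
  · rw [add_comm]
  rcases eq_or_ne (α + β) 0 with h0 | h0
  · obtain rfl : β = -α := by linarith
    rw [← norm_neg]
    congr 1
    module
  · have h := hL.norm_add_smul_eq_norm_sub_smul (sub_ne_zero.2 hne)
      (hL.norm_add_le_norm_add_smul_sub huv) ((α - β) / (α + β))
    have h' := congrArg (fun c : ℝ => ‖(α + β) / 2‖ * c) h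
    simp only [← norm_smul] at h'
    convert h' using 2
    · match_scalars <;> field_simp <;> ring
    · match_scalars <;> field_simp <;> ring

theorem sq_add_sq_eq_one (hL : LorchCondition X) {e f : X} (he : ‖e‖ = 1) (hf : ‖f‖ = 1)
    (hef : ∀ s : ℝ, ∀ t : ℝ, ‖s • e + t • f‖ = ‖s • e - t • f‖) {c s : ℝ}
    (hcs : ‖c • e + s • f‖ = 1) : c ^ 2 + s ^ 2 = 1 := by
  have hf0 : f ≠ 0 := norm_ne_zero_iff.1 (by rw [hf]; exact one_ne_zero)
  have hmin : ∀ t : ℝ, ‖c • e‖ ≤ ‖c • e + t • f‖ := fun t => by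
    have h := norm_add_le (c • e + t • f) (c • e - t • f)
    rw [← hef, show c • e + t • f + (c • e - t • f) = (2 : ℝ) • (c • e) by module,
      norm_smul, Real.norm_two] at h
    linarith
  have hc1 : c ^ 2 ≤ 1 := by
    have h := hmin s
    rw [hcs, norm_smul, he, mul_one] at h
    exact (sq_le_one_iff_abs_le_one c).2 h
  rcases eq_or_ne s 0 with rfl | hs
  · rw [zero_smul, add_zero, norm_smul, he, mul_one, Real.norm_eq_abs] at hcs
    rw [← sq_abs, hcs]
    norm_num
  have h1 := hL.norm_smul_add_smul_swap (he.trans hcs.symm) (-c / s) (1 / s)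
  rw [show (-c / s) • e + (1 / s) • (c • e + s • f) = f by
      match_scalars <;> field_simp; ring,
    show (1 / s) • e + (-c / s) • (c • e + s • f) = ((1 - c ^ 2) / s) • e + (-c) • f by
      match_scalars <;> field_simp; ring,
    hL.norm_smul_add_smul_swap (he.trans hf.symm), hf, ← norm_neg,
    show -((-c) • e + ((1 - c ^ 2) / s) • f) = c • e - ((1 - c ^ 2) / s) • f by module,
    ← hef] at h1
  rcases hL.eq_or_add_eq_zero_of_norm_eq hf0 hmin (hcs.trans h1) with h | h
  · field_simp at h
    linarith
  · field_simp at h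
    have : 0 < s ^ 2 := by positivity
    linarith

theorem norm_sq_eq (hL : LorchCondition X) {e f : X} (he : ‖e‖ = 1) (hf : ‖f‖ = 1)
    (hef : ∀ s : ℝ, ∀ t : ℝ, ‖s • e + t • f‖ = ‖s • e - t • f‖) (c s : ℝ) :
    ‖c • e + s • f‖ ^ 2 = c ^ 2 + s ^ 2 := by
  set N := ‖c • e + s • f‖ with hN
  rcases eq_or_ne N 0 with h0 | h0
  · have h1 : c • e + s • f = 0 := norm_eq_zero.1 h0
    have h2 : c • e - s • f = 0 := norm_eq_zero.1 ((hef c s).symm.trans h0)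
    have h3 : (2 * c) • e = 0 := by
      rw [show (2 * c) • e = (c • e + s • f) + (c • e - s • f) by module, h1, h2, add_zero]
    have h4 : (2 * s) • f = 0 := by
      rw [show (2 * s) • f = (c • e + s • f) - (c • e - s • f) by module, h1, h2, sub_zero]
    have h5 := congrArg norm h3
    have h6 := congrArg norm h4
    rw [norm_smul, he, norm_zero, mul_one, norm_eq_zero] at h5
    rw [norm_smul, hf, norm_zero, mul_one, norm_eq_zero] at h6
    obtain rfl : c = 0 := by linarith
    obtain rfl : s = 0 := by linarith
    simp [h0]
  · have h := hL.sq_add_sq_eq_one he hf hef (c := N⁻¹ * c) (s := N⁻¹ * s) (by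
      rw [mul_smul, mul_smul, ← smul_add, norm_smul, ← hN, norm_inv, hN, norm_norm]
      exact inv_mul_cancel₀ h0)
    field_simp at h
    exact h.symm

theorem parallelogram_law (hL : LorchCondition X) (x y : X) :
    ‖x + y‖ ^ 2 + ‖x - y‖ ^ 2 = 2 * ‖x‖ ^ 2 + 2 * ‖y‖ ^ 2 := by
  rcases eq_or_ne x 0 with rfl | hx
  · rw [zero_add, zero_sub, norm_neg, norm_zero]
    ring
  have hx' : ‖x‖ ≠ 0 := norm_ne_zero_iff.2 hx
  obtain ⟨e, he, hxe⟩ : ∃ e : X, ‖e‖ = 1 ∧ x = ‖x‖ • e :=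
    ⟨‖x‖⁻¹ • x, by rw [norm_smul, norm_inv, norm_norm, inv_mul_cancel₀ hx'],
      by rw [smul_smul, mul_inv_cancel₀ hx', one_smul]⟩
  have he0 : e ≠ 0 := norm_ne_zero_iff.1 (by rw [he]; exact one_ne_zero)
  obtain ⟨r, hr⟩ := exists_forall_norm_le_norm_add_smul he y
  have hsym := hL.norm_add_smul_eq_norm_sub_smul he0 hr
  set b := y + r • e with hb
  generalize ‖x‖ = k at hxe
  have hy : y = (-r) • e + b := by rw [hb]; module
  clear_value b
  subst hxe hy
  rcases eq_or_ne b 0 with rfl | hb0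
  · rw [add_zero, ← add_smul, ← sub_smul]
    simp only [norm_smul, he, mul_one, Real.norm_eq_abs, sq_abs]
    ring
  have hb' : ‖b‖ ≠ 0 := norm_ne_zero_iff.2 hb0
  obtain ⟨f, hf, hbf⟩ : ∃ f : X, ‖f‖ = 1 ∧ b = ‖b‖ • f :=
    ⟨‖b‖⁻¹ • b, by rw [norm_smul, norm_inv, norm_norm, inv_mul_cancel₀ hb'],
      by rw [smul_smul, mul_inv_cancel₀ hb', one_smul]⟩
  generalize ‖b‖ = m at hbf hb'
  subst hbf
  have hef : ∀ s t : ℝ, ‖s • e + t • f‖ = ‖s • e - t • f‖ := fun s t => by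
    rcases eq_or_ne t 0 with rfl | ht
    · simp
    have h := congrArg (fun c : ℝ => ‖t / m‖ * c) (hsym (m * s / t))
    simp only [← norm_smul] at h
    rw [norm_sub_rev (s • e),
      show s • e + t • f = (t / m) • (m • f + (m * s / t) • e) by
        match_scalars <;> field_simp,
      show t • f - s • e = (t / m) • (m • f - (m * s / t) • e) by
        match_scalars <;> field_simp]
    exact h
  have hN := hL.norm_sq_eq he hf hef
  rw [show k • e + ((-r) • e + m • f) = (k - r) • e + m • f by module,
    show k • e - ((-r) • e + m • f) = (k + r) • e + (-m) • f by module,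
    hN, hN, hN]
  ring

end LorchCondition

theorem two_rpow_mul_sqrt_mul_le {A B q : ℝ} (hA : 0 < A) (hB : 0 < B) (hq : 0 < q) :
    2 ^ (1 / q) * √(A * B) ≤ (A ^ q + B ^ q) ^ (1 / q) := by
  have h : 2 * √(A * B) ^ q ≤ A ^ q + B ^ q := by
    rw [Real.sqrt_mul hA.le, Real.mul_rpow (Real.sqrt_nonneg _) (Real.sqrt_nonneg _)]
    have key : ∀ {C : ℝ}, 0 < C → C ^ q = (√C ^ q) ^ 2 := fun {C} hC => by
      rw [← Real.rpow_natCast, ← Real.rpow_mul (Real.sqrt_nonneg _), mul_comm q,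
        Real.rpow_mul (Real.sqrt_nonneg _), Real.rpow_natCast, Real.sq_sqrt hC.le]
    rw [key hA, key hB]
    linarith [two_mul_le_add_sq (√A ^ q) (√B ^ q)]
  calc 2 ^ (1 / q) * √(A * B) = (2 * √(A * B) ^ q) ^ (1 / q) := by
        rw [Real.mul_rpow zero_le_two (by positivity), ← Real.rpow_mul (Real.sqrt_nonneg _),
          mul_one_div_cancel hq.ne', Real.rpow_one]
    _ ≤ _ := by gcongr

theorem rpow_add_rpow_rpow_inv_le {A B q : ℝ} (hA : 0 < A) (hB : 0 < B) (hq : 0 < q)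
    (hq1 : q ≤ 1) : (A ^ q + B ^ q) ^ (1 / q) ≤ 2 ^ (1 / q) * ((A + B) / 2) := by
  have h := (convexOn_rpow ((one_le_div hq).2 hq1)).2 (Real.rpow_nonneg hA.le q)
    (Real.rpow_nonneg hB.le q) one_half_pos.le one_half_pos.le (add_halves (1 : ℝ))
  simp only [smul_eq_mul] at h
  rw [← Real.rpow_mul hA.le, ← Real.rpow_mul hB.le, mul_one_div_cancel hq.ne', Real.rpow_one,
    Real.rpow_one, ← mul_add, ← mul_add] at h
  calc (A ^ q + B ^ q) ^ (1 / q) = 2 ^ (1 / q) * (1 / 2 * (A ^ q + B ^ q)) ^ (1 / q) := by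
        rw [← Real.mul_rpow zero_le_two (by positivity)]
        congr 1
        ring
    _ ≤ 2 ^ (1 / q) * ((A + B) / 2) := by
        gcongr
        linarith

theorem norm_rpow_smul_add_sq_le {p q : ℝ} (hq : 0 < q)
    (h : ∀ x y : X, x ≠ 0 → y ≠ 0 → ‖(‖x‖ ^ (p - 1)) • x - (‖y‖ ^ (p - 1)) • y‖ ≤
      2 ^ (1 / q) * ‖x - y‖ / (‖x‖ ^ ((1 - p) * q) + ‖y‖ ^ ((1 - p) * q)) ^ (1 / q))
    {u v : X} (hu : ‖u‖ = 1) (hv : ‖v‖ = 1) {α β : ℝ} (hα : 0 < α) (hβ : 0 < β) :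
    ‖α ^ p • u + β ^ p • v‖ ^ 2 / (α ^ p * β ^ p) ≤ ‖α • u + β • v‖ ^ 2 / (α * β) := by
  have hx : ‖α • u‖ = α := by rw [norm_smul, hu, mul_one, Real.norm_of_nonneg hα.le]
  have hy : ‖(-β) • v‖ = β := by rw [norm_smul, hv, mul_one, norm_neg, Real.norm_of_nonneg hβ.le]
  have h1 := h (α • u) ((-β) • v) (norm_ne_zero_iff.1 (by rw [hx]; exact hα.ne'))
    (norm_ne_zero_iff.1 (by rw [hy]; exact hβ.ne'))
  have hmul : ∀ {γ : ℝ}, 0 < γ → γ ^ (p - 1) * γ = γ ^ p := fun {γ} hγ => by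
    rw [← Real.rpow_add_one hγ.ne', sub_add_cancel]
  rw [hx, hy, smul_smul, smul_smul, mul_neg, hmul hα, hmul hβ, neg_smul, neg_smul,
    sub_neg_eq_add, sub_neg_eq_add, Real.rpow_mul hα.le, Real.rpow_mul hβ.le,
    le_div_iff₀ (by positivity)] at h1
  have hA : 0 < α ^ (1 - p) := by positivity
  have hB : 0 < β ^ (1 - p) := by positivity
  have h2 := (mul_le_mul_of_nonneg_left (two_rpow_mul_sqrt_mul_le hA hB hq)
    (norm_nonneg (α ^ p • u + β ^ p • v))).trans h1
  rw [mul_left_comm] at h2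
  have h3 := pow_le_pow_left₀ (by positivity) (le_of_mul_le_mul_left h2 (by positivity)) 2
  rw [mul_pow, Real.sq_sqrt (by positivity)] at h3
  have hα' : α ^ (1 - p) * α ^ p = α := by rw [← Real.rpow_add hα]; simp
  have hβ' : β ^ (1 - p) * β ^ p = β := by rw [← Real.rpow_add hβ]; simp
  rw [div_le_div_iff₀ (by positivity) (by positivity)]
  calc _ = ‖α ^ p • u + β ^ p • v‖ ^ 2 * (α ^ (1 - p) * β ^ (1 - p)) * (α ^ p * β ^ p) := by
        nth_rewrite 2 [← hα']
        nth_rewrite 2 [← hβ']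
        ring
    _ ≤ _ := by gcongr

theorem lorchCondition_of_norm_rpow_smul_sub_le {p q : ℝ} (hp : p ∈ Set.Ico (0 : ℝ) 1)
    (hq : 0 < q)
    (h : ∀ x y : X, x ≠ 0 → y ≠ 0 → ‖(‖x‖ ^ (p - 1)) • x - (‖y‖ ^ (p - 1)) • y‖ ≤
      2 ^ (1 / q) * ‖x - y‖ / (‖x‖ ^ ((1 - p) * q) + ‖y‖ ^ ((1 - p) * q)) ^ (1 / q)) :
    LorchCondition X := by
  have unit : ∀ u v : X, ‖u‖ = 1 → ‖v‖ = 1 → ∀ α β : ℝ, 0 < α → 0 < β →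
      α * β * ‖u + v‖ ^ 2 ≤ ‖α • u + β • v‖ ^ 2 := by
    intro u v hu hv α β hα hβ
    have iter : ∀ n : ℕ, ‖α ^ p ^ n • u + β ^ p ^ n • v‖ ^ 2 / (α ^ p ^ n * β ^ p ^ n) ≤
        ‖α • u + β • v‖ ^ 2 / (α * β) := by
      intro n
      induction n with
      | zero => simp
      | succ n ih =>
        have h1 := norm_rpow_smul_add_sq_le hq h hu hv
          (Real.rpow_pos_of_pos hα (p ^ n)) (Real.rpow_pos_of_pos hβ (p ^ n))
        rw [← Real.rpow_mul hα.le, ← Real.rpow_mul hβ.le, ← pow_succ] at h1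
        exact h1.trans ih
    have hp0 := tendsto_pow_atTop_nhds_zero_of_lt_one hp.1 hp.2
    have hlim : ∀ {γ : ℝ}, 0 < γ →
        Filter.Tendsto (fun n : ℕ => γ ^ p ^ n) Filter.atTop (nhds 1) := fun {γ} hγ => by
      have := (Real.continuousAt_const_rpow (b := 0) hγ.ne').tendsto.comp hp0
      rwa [Real.rpow_zero] at this
    have ht := (((((hlim hα).smul_const u).add ((hlim hβ).smul_const v)).norm.pow 2).div
      ((hlim hα).mul (hlim hβ)) (by norm_num))
    have hle := le_of_tendsto' ht iter
    rw [one_smul, one_smul, mul_one, div_one, le_div_iff₀ (by positivity)] at hle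
    linarith
  intro u v huv α β hα hβ
  rcases eq_or_ne u 0 with rfl | hu
  · rw [norm_zero, eq_comm, norm_eq_zero] at huv
    simp [huv]
  have hu' : 0 < ‖u‖ := norm_pos_iff.2 hu
  have h1 := unit (‖u‖⁻¹ • u) (‖u‖⁻¹ • v)
    (by rw [norm_smul, norm_inv, norm_norm, inv_mul_cancel₀ hu'.ne'])
    (by rw [norm_smul, norm_inv, norm_norm, ← huv, inv_mul_cancel₀ hu'.ne']) α β hα hβ
  rw [smul_comm α, smul_comm β, ← smul_add, ← smul_add, norm_smul, norm_smul, mul_pow, mul_pow,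
    mul_left_comm] at h1
  exact le_of_mul_le_mul_left h1 (pow_pos (norm_pos_iff.2 (norm_ne_zero_iff.1 (by
    rw [norm_inv, norm_norm]; exact (inv_pos.2 hu').ne'))) 2)

end NormedSpace

theorem norm_inv_smul_sub_inv_smul_mul_le {E : Type*} [NormedAddCommGroup E]
    [InnerProductSpace ℝ E] {x y : E} {A B P Q : ℝ} (hA : 0 < A) (hB : 0 < B)
    (hP : 0 ≤ P) (hQ : 0 ≤ Q) (hx : ‖x‖ = A * P) (hy : ‖y‖ = B * Q)
    (hmono : 0 ≤ (A - B) * (P - Q)) :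
    ‖A⁻¹ • x - B⁻¹ • y‖ * ((A + B) / 2) ≤ ‖x - y‖ := by
  obtain ⟨u, hxu⟩ : ∃ u : E, x = A • u := ⟨A⁻¹ • x, by rw [smul_inv_smul₀ hA.ne']⟩
  obtain ⟨v, hyv⟩ : ∃ v : E, y = B • v := ⟨B⁻¹ • y, by rw [smul_inv_smul₀ hB.ne']⟩
  subst hxu hyv
  rw [inv_smul_smul₀ hA.ne', inv_smul_smul₀ hB.ne']
  rw [norm_smul, Real.norm_of_nonneg hA.le] at hx
  rw [norm_smul, Real.norm_of_nonneg hB.le] at hy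
  have hu := mul_left_cancel₀ hA.ne' hx
  have hv := mul_left_cancel₀ hB.ne' hy
  obtain ⟨h1, h2⟩ := abs_le.1 (abs_real_inner_le_norm u v)
  rw [hu, hv] at h1 h2
  refine (sq_le_sq₀ (by positivity) (norm_nonneg _)).1 ?_
  rw [mul_pow, norm_sub_sq_real, norm_sub_sq_real, norm_smul, norm_smul, hu, hv,
    Real.norm_of_nonneg hA.le, Real.norm_of_nonneg hB.le, real_inner_smul_left,
    real_inner_smul_right]
  have h3 : (P + Q) * ((A + B) / 2) ≤ A * P + B * Q := by linarith
  have h4 := pow_le_pow_left₀ (by positivity) h3 2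
  have h5 : 0 ≤ (inner ℝ u v + P * Q) * (A - B) ^ 2 := mul_nonneg (by linarith) (sq_nonneg _)
  linarith

theorem norm_rpow_smul_sub_le_of_inner {E : Type*} [NormedAddCommGroup E]
    [InnerProductSpace ℝ E] {p q : ℝ} (hp : p ∈ Set.Ico (0 : ℝ) 1) (hq : q ∈ Set.Ioc (0 : ℝ) 1)
    {x y : E} (hx : x ≠ 0) (hy : y ≠ 0) :
    ‖(‖x‖ ^ (p - 1)) • x - (‖y‖ ^ (p - 1)) • y‖ ≤
      2 ^ (1 / q) * ‖x - y‖ / (‖x‖ ^ ((1 - p) * q) + ‖y‖ ^ ((1 - p) * q)) ^ (1 / q) := by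
  have hx' : 0 < ‖x‖ := norm_pos_iff.2 hx
  have hy' : 0 < ‖y‖ := norm_pos_iff.2 hy
  have hsplit : ∀ {a : ℝ}, 0 < a → a = a ^ (1 - p) * a ^ p := fun {a} ha => by
    rw [← Real.rpow_add ha, sub_add_cancel, Real.rpow_one]
  have hinv : ∀ {a : ℝ}, 0 < a → a ^ (p - 1) = (a ^ (1 - p))⁻¹ := fun {a} ha => by
    rw [← Real.rpow_neg ha.le, neg_sub]
  have hA := Real.rpow_pos_of_pos hx' (1 - p)
  have hB := Real.rpow_pos_of_pos hy' (1 - p)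
  have hp' : 0 ≤ 1 - p := sub_nonneg.2 hp.2.le
  have hmono : 0 ≤ (‖x‖ ^ (1 - p) - ‖y‖ ^ (1 - p)) * (‖x‖ ^ p - ‖y‖ ^ p) := by
    rcases le_total ‖x‖ ‖y‖ with h | h
    · exact mul_nonneg_of_nonpos_of_nonpos
        (sub_nonpos.2 (Real.rpow_le_rpow hx'.le h hp'))
        (sub_nonpos.2 (Real.rpow_le_rpow hx'.le h hp.1))
    · exact mul_nonneg (sub_nonneg.2 (Real.rpow_le_rpow hy'.le h hp'))
        (sub_nonneg.2 (Real.rpow_le_rpow hy'.le h hp.1))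
  have h1 := norm_inv_smul_sub_inv_smul_mul_le hA hB (Real.rpow_nonneg hx'.le p)
    (Real.rpow_nonneg hy'.le p) (hsplit hx') (hsplit hy') hmono
  rw [hinv hx', hinv hy', Real.rpow_mul hx'.le, Real.rpow_mul hy'.le,
    le_div_iff₀ (by positivity)]
  calc _ ≤ ‖(‖x‖ ^ (1 - p))⁻¹ • x - (‖y‖ ^ (1 - p))⁻¹ • y‖ *
        (2 ^ (1 / q) * ((‖x‖ ^ (1 - p) + ‖y‖ ^ (1 - p)) / 2)) := by
        gcongr
        exact rpow_add_rpow_rpow_inv_le hA hB hq.1 hq.2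
    _ = 2 ^ (1 / q) * (‖(‖x‖ ^ (1 - p))⁻¹ • x - (‖y‖ ^ (1 - p))⁻¹ • y‖ *
        ((‖x‖ ^ (1 - p) + ‖y‖ ^ (1 - p)) / 2)) := by ring
    _ ≤ _ := by gcongr


theorem main_theorem {X : Type*} [NormedAddCommGroup X] [NormedSpace ℝ X]
    (p : ℝ) (hp : p ∈ Set.Ico (0:ℝ) 1) :
    ((∀ q : ℝ, q ∈ Set.Ioc (0:ℝ) 1 → ∀ x y : X, x ≠ 0 → y ≠ 0 →
        ‖(‖x‖ ^ (p - 1)) • x - (‖y‖ ^ (p - 1)) • y‖ ≤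
          2 ^ (1 / q) * ‖x - y‖ / (‖x‖ ^ ((1 - p) * q) + ‖y‖ ^ ((1 - p) * q)) ^ (1 / q)) ↔
      (∃ q : ℝ, 0 < q ∧ ∀ x y : X, x ≠ 0 → y ≠ 0 →
        ‖(‖x‖ ^ (p - 1)) • x - (‖y‖ ^ (p - 1)) • y‖ ≤
          2 ^ (1 / q) * ‖x - y‖ / (‖x‖ ^ ((1 - p) * q) + ‖y‖ ^ ((1 - p) * q)) ^ (1 / q)))
    ∧ ((∃ q : ℝ, 0 < q ∧ ∀ x y : X, x ≠ 0 → y ≠ 0 →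
        ‖(‖x‖ ^ (p - 1)) • x - (‖y‖ ^ (p - 1)) • y‖ ≤
          2 ^ (1 / q) * ‖x - y‖ / (‖x‖ ^ ((1 - p) * q) + ‖y‖ ^ ((1 - p) * q)) ^ (1 / q)) ↔
      (∀ x y : X, ‖x + y‖ ^ 2 + ‖x - y‖ ^ 2 = 2 * ‖x‖ ^ 2 + 2 * ‖y‖ ^ 2)) := by
  have of_parallelogram : (∀ x y : X, ‖x + y‖ ^ 2 + ‖x - y‖ ^ 2 = 2 * ‖x‖ ^ 2 + 2 * ‖y‖ ^ 2) →
      ∀ q : ℝ, q ∈ Set.Ioc (0 : ℝ) 1 → ∀ x y : X, x ≠ 0 → y ≠ 0 →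
        ‖(‖x‖ ^ (p - 1)) • x - (‖y‖ ^ (p - 1)) • y‖ ≤
          2 ^ (1 / q) * ‖x - y‖ / (‖x‖ ^ ((1 - p) * q) + ‖y‖ ^ ((1 - p) * q)) ^ (1 / q) := by
    intro h q hq x y hx hy
    let _ : InnerProductSpace ℝ X := InnerProductSpace.ofNorm ℝ fun x y => by
      linarith [h x y]
    exact norm_rpow_smul_sub_le_of_inner hp hq hx hy
  have one_mem : (1 : ℝ) ∈ Set.Ioc (0 : ℝ) 1 := ⟨one_pos, le_rfl⟩
  refine ⟨⟨fun h => ⟨1, one_pos, h 1 one_mem⟩, ?_⟩, ?_, fun h => ⟨1, one_pos,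
    of_parallelogram h 1 one_mem⟩⟩
  · rintro ⟨q, hq, h⟩
    exact of_parallelogram (lorchCondition_of_norm_rpow_smul_sub_le hp hq h).parallelogram_law
  · rintro ⟨q, hq, h⟩
    exact (lorchCondition_of_norm_rpow_smul_sub_le hp hq h).parallelogram_law
end
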